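/- arXiv:1810.12726 — 2 statements merged into one kernel-verified Lean document; each statement's English description precedes it below -/
import Mathlib

section
/- Kramers degeneracy: let V be a complex vector space, Θ : V → V an additive conjugate-linear map (Θ (c • x) = (starRingEnd ℂ c) • Θ x) with Θ (Θ x) = -x for all x, and T : V → V a complex-linear map commuting with Θ. For any real number E, if the eigenspace ker (T - E • id) is finite-dimensional, then its complex dimension is even; in particular every nonzero eigenvector of a time reversal invariant operator has a twofold degenerate eigenvalue. -/
/-- A finite-dimensional complex vector space carrying a conjugate-linear map of square `-1`
(a quaternionic structure) has even dimension. -/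
theorem even_finrank_of_conjLinear_sq_eq_neg {W : Type*} [AddCommGroup W] [Module ℂ W]
    [FiniteDimensional ℂ W] (J : W →ₛₗ[starRingEnd ℂ] W) (hJ : ∀ x, J (J x) = -x) :
    Even (Module.finrank ℂ W) := by
  let b := Module.finBasis ℂ W
  let M : Matrix (Fin (Module.finrank ℂ W)) (Fin (Module.finrank ℂ W)) ℂ :=
    Matrix.of fun i j => b.repr (J (b j)) i
  have hM : M * M.map (starRingEnd ℂ) = -1 := by
    ext k j
    have h : J (J (b j)) = ∑ i, starRingEnd ℂ (M i j) • J (b i) := by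
      conv_lhs => rw [← b.sum_repr (J (b j))]
      simp only [map_sum, LinearMap.map_smulₛₗ, M, Matrix.of_apply]
    rw [hJ] at h
    have hk := congrArg (fun x => b.repr x k) h
    simp only [map_neg, map_sum, map_smul, Finsupp.neg_apply, Finsupp.finsetSum_apply,
      Finsupp.smul_apply, smul_eq_mul, Module.Basis.repr_self] at hk
    rw [Matrix.mul_apply, Matrix.neg_apply, Matrix.one_apply]
    simpa [M, mul_comm, Finsupp.single_apply, eq_comm] using hk.symm
  have hdet : ((Complex.normSq M.det : ℝ) : ℂ) = (-1) ^ Module.finrank ℂ W := by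
    have h := congrArg Matrix.det hM
    rw [Matrix.det_mul, ← RingHom.mapMatrix_apply, ← RingHom.map_det, Complex.mul_conj,
      Matrix.det_neg] at h
    simpa using h
  by_contra hodd
  rw [(Nat.not_even_iff_odd.mp hodd).neg_one_pow] at hdet
  have hreal : Complex.normSq M.det = -1 := by exact_mod_cast hdet
  linarith [Complex.normSq_nonneg M.det]

/-- Kramers degeneracy: the eigenspaces of a time reversal invariant operator
have even complex dimension (when finite-dimensional). -/
theorem kramers_degeneracy
    {V : Type*} [AddCommGroup V] [Module ℂ V]
    (Θ : V → V)
    (hadd : ∀ x y : V, Θ (x + y) = Θ x + Θ y)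
    (hconj : ∀ (c : ℂ) (x : V), Θ (c • x) = (starRingEnd ℂ c) • Θ x)
    (hsq : ∀ x : V, Θ (Θ x) = -x)
    (T : V →ₗ[ℂ] V) (hT : ∀ x : V, T (Θ x) = Θ (T x))
    (E : ℝ)
    (hfin : FiniteDimensional ℂ (LinearMap.ker (T - (E : ℂ) • LinearMap.id))) :
    Even (Module.finrank ℂ (LinearMap.ker (T - (E : ℂ) • LinearMap.id))) := by
  have hmem (x : V) (hx : x ∈ LinearMap.ker (T - (E : ℂ) • LinearMap.id)) :
      Θ x ∈ LinearMap.ker (T - (E : ℂ) • LinearMap.id) := by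
    simp only [LinearMap.mem_ker, LinearMap.sub_apply, LinearMap.smul_apply,
      LinearMap.id_apply, sub_eq_zero] at hx ⊢
    rw [hT, hx, hconj, Complex.conj_ofReal]
  let J : LinearMap.ker (T - (E : ℂ) • LinearMap.id) →ₛₗ[starRingEnd ℂ]
      LinearMap.ker (T - (E : ℂ) • LinearMap.id) :=
    { toFun := fun x => ⟨Θ x, hmem x x.2⟩
      map_add' := fun x y => Subtype.ext (hadd x y)
      map_smul' := fun c x => Subtype.ext (hconj c x) }
  exact even_finrank_of_conjLinear_sq_eq_neg J fun x => Subtype.ext (hsq x)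
end

section
/- Let A be a unital complex star algebra, θ : ℝ, and u, v ∈ A unitaries satisfying u * v = Complex.exp (2 * Real.pi * Complex.I * θ) • (v * u). Let Θ be a time reversal symmetry on A with Θ u = star v and Θ v = -star u. Then the elements x := (Complex.I * Complex.exp (Real.pi * Complex.I * θ)) • (u * star v) and y := (Complex.I * Complex.exp (-(Real.pi) * Complex.I * θ)) • (v * star u) are fixed by the time reversal symmetry: Θ x = x and Θ y = y. -/
/-- If `v` is invertible with inverse `star v` and `u * v = q • (v * u)`, then `star v` passes
through `u` with the same scalar. -/
theorem star_mul_eq_smul_mul_star {A : Type*} [Ring A] [Algebra ℂ A] [StarRing A]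
    {q : ℂ} {u v : A} (hv : star v * v = 1 ∧ v * star v = 1) (huv : u * v = q • (v * u)) :
    star v * u = q • (u * star v) := by
  calc star v * u = star v * (u * v) * star v := by
        rw [mul_assoc, mul_assoc, hv.2, mul_one]
    _ = q • (u * star v) := by
        rw [huv, mul_smul_comm, smul_mul_assoc, ← mul_assoc, hv.1, one_mul]

/-- If `u` is invertible with inverse `star u` and `u * v = q • (v * u)`, then `star u` passes
through `v` with the same scalar. -/
theorem mul_star_eq_smul_star_mul {A : Type*} [Ring A] [Algebra ℂ A] [StarRing A]
    {q : ℂ} {u v : A} (hu : star u * u = 1 ∧ u * star u = 1) (huv : u * v = q • (v * u)) :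
    v * star u = q • (star u * v) := by
  calc v * star u = star u * (u * v) * star u := by
        rw [← mul_assoc, hu.1, one_mul]
    _ = q • (star u * v) := by
        rw [huv, mul_smul_comm, smul_mul_assoc, mul_assoc, mul_assoc, hu.2, mul_one]

/-- The elements `x = i e^{πiθ} u v*` and `y = i e^{-πiθ} v u*` of the
noncommutative 2-torus are fixed by the time reversal symmetry. -/
theorem ncTorus_fixedPoint_generators
    {A : Type*} [Ring A] [Algebra ℂ A] [StarRing A] [StarModule ℂ A]
    (θ : ℝ) (u v : A)
    (hu : star u * u = 1 ∧ u * star u = 1)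
    (hv : star v * v = 1 ∧ v * star v = 1)
    (huv : u * v = Complex.exp (2 * Real.pi * Complex.I * θ) • (v * u))
    (Θ : A → A)
    (hadd : ∀ a b : A, Θ (a + b) = Θ a + Θ b)
    (hmul : ∀ a b : A, Θ (a * b) = Θ a * Θ b)
    (hconj : ∀ (c : ℂ) (a : A), Θ (c • a) = (starRingEnd ℂ c) • Θ a)
    (hstar : ∀ a : A, Θ (star a) = star (Θ a))
    (hΘu : Θ u = star v) (hΘv : Θ v = -star u) :
    Θ ((Complex.I * Complex.exp (Real.pi * Complex.I * θ)) • (u * star v)) =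
      (Complex.I * Complex.exp (Real.pi * Complex.I * θ)) • (u * star v) ∧
    Θ ((Complex.I * Complex.exp (-(Real.pi) * Complex.I * θ)) • (v * star u)) =
      (Complex.I * Complex.exp (-(Real.pi) * Complex.I * θ)) • (v * star u) := by
  constructor
  · rw [hconj, hmul, hstar, hΘu, hΘv, star_neg, star_star, mul_neg,
      star_mul_eq_smul_mul_star hv huv, smul_neg, smul_smul, ← neg_smul]
    congr 1
    simp only [map_mul, Complex.conj_I, ← Complex.exp_conj, Complex.conj_ofReal]
    rw [neg_mul, neg_mul, neg_neg, mul_assoc Complex.I, ← Complex.exp_add]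
    congr 2
    ring
  · rw [hconj, hmul, hstar, hΘu, hΘv, star_star, neg_mul (star u),
      mul_star_eq_smul_star_mul hu huv, smul_neg, smul_smul, ← neg_smul]
    congr 1
    simp only [map_mul, map_neg, Complex.conj_I, ← Complex.exp_conj, Complex.conj_ofReal]
    rw [neg_mul Complex.I, neg_neg, mul_assoc Complex.I, ← Complex.exp_add]
    congr 2
    ring
end
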